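/- arXiv:1505.07807 — 2 statements merged into one kernel-verified Lean document; each statement's English description precedes it below -/
import Mathlib

section
/- Let (X,d) be a (possibly infinite) metric space with integer-valued metric satisfying the local rank condition, and let f ∈ E(X,d) be such that the cell [f] is X-gated; for each x ∈ X let γ^x_{[f]} ∈ [f] denote the gate of d_x in [f], and let G([f]) = {γ^x_{[f]} : x ∈ X} be the set of gates, equipped with the metric d_∞. Then: (i) (G([f]), d_∞) is an antipodal metric space; (ii) the map Φ: [f] → E(G([f]), d_∞) defined by Φ(g)(γ) = d_∞(g, γ) for γ ∈ G([f]) (equivalently, Φ(g)(γ^x_{[f]}) = g(x) − γ^x_{[f]}(x)) is a well-defined bijective isometry from ([f], d_∞) onto E(G([f]), d_∞), and it is the restriction of an affine map. -/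
open Set Function

noncomputable section

variable {X : Type*}

/-- `d` is a pseudometric on `X`. -/
def IsPseudometric (d : X → X → ℝ) : Prop :=
  (∀ x, d x x = 0) ∧ (∀ x y, d x y = d y x) ∧ ∀ x y z, d x z ≤ d x y + d y z

/-- `d` is a metric on `X`. -/
def IsMetric (d : X → X → ℝ) : Prop :=
  IsPseudometric d ∧ ∀ x y, d x y = 0 → x = y

/-- `d` is integer-valued. -/
def IsIntegerValued (d : X → X → ℝ) : Prop := ∀ x y, ∃ n : ℤ, d x y = (n : ℝ)

/-- The quantity `β^d` associated to the four points `a, a', b, b'`. -/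
def betaIdx (d : X → X → ℝ) (a a' b b' : X) : ℝ :=
  (max (max (d a b + d a' b') (d a' b + d a b')) (d a a' + d b b') - d a a' - d b b') / 2

/-- The isolation index `α^d_{{A,B}}` of the pair `{A,B}`. -/
def isolIdx (d : X → X → ℝ) (A B : Set X) : ℝ :=
  sInf {r : ℝ | ∃ a ∈ A, ∃ a' ∈ A, ∃ b ∈ B, ∃ b' ∈ B, r = betaIdx d a a' b b'}

/-- `{A, B}` is a partial split of `X`. -/
def IsPartialSplit (A B : Set X) : Prop := A.Nonempty ∧ B.Nonempty ∧ Disjoint A B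

/-- `{A, B}` is a split of `X`. -/
def IsSplit (A B : Set X) : Prop := IsPartialSplit A B ∧ A ∪ B = univ

/-- `{A, B}` is a `d`-split of `X`. -/
def IsDSplit (d : X → X → ℝ) (A B : Set X) : Prop := IsSplit A B ∧ 0 < isolIdx d A B

open Classical in
/-- The split pseudometric `δ_S` of the split `{A, Aᶜ}`. -/
def splitDist (A : Set X) (x y : X) : ℝ := if x ∈ A ↔ y ∈ A then 0 else 1

/-- `Δ(X, ρ)`: functions with `f x + f y ≥ ρ x y` for all `x, y`. -/
def DeltaSet (ρ : X → X → ℝ) : Set (X → ℝ) := {f | ∀ x y, ρ x y ≤ f x + f y}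

/-- Isbell's injective hull `E(X, d)`: the extremal functions, i.e. those with
`f x = sup_y (d x y - f y)` for every `x`. -/
def ExtSet (d : X → X → ℝ) : Set (X → ℝ) :=
  {f | ∀ x, IsLUB {r : ℝ | ∃ y, r = d x y - f y} (f x)}

/-- `E'(X, d)`: elements of `Δ(X, d)` such that every point lies in some pair of `A(f)`. -/
def ExtSet' (d : X → X → ℝ) : Set (X → ℝ) :=
  {f | f ∈ DeltaSet d ∧ ∀ x, ∃ y, f x + f y = d x y}

/-- The set `A(f)` of (ordered) pairs where equality holds. -/
def eqSet (d : X → X → ℝ) (f : X → ℝ) : Set (X × X) := {p | f p.1 + f p.2 = d p.1 p.2}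

/-- The direction space of the affine subspace `H(A)`; its dimension is `rank A`. -/
def dirSubmodule (A : Set (X × X)) : Submodule ℝ (X → ℝ) where
  carrier := {h | ∀ p ∈ A, h p.1 + h p.2 = 0}
  add_mem' := by
    intro a b ha hb p hp
    have h1 := ha p hp
    have h2 := hb p hp
    simp only [Pi.add_apply]
    linarith
  zero_mem' := by intro p _; simp
  smul_mem' := by
    intro c a ha p hp
    have h1 := ha p hp
    simp only [Pi.smul_apply, smul_eq_mul]
    linear_combination c * h1

/-- The local rank condition. -/
def LRC (d : X → X → ℝ) : Prop :=
  ∀ f ∈ ExtSet d, ∃ ε : ℝ, 0 < ε ∧ ∃ N : ℕ,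
    ∀ g ∈ ExtSet' d, (∀ x, |f x - g x| < ε) →
      Module.rank ℝ (dirSubmodule (eqSet d g)) ≤ (N : Cardinal)

/-- `d` is totally split-decomposable: `d = ∑_{S a d-split} α_S δ_S`, where each
separating `d`-split `{A, Aᶜ}` is counted once via its part `A` containing `x`. -/
def TSD (d : X → X → ℝ) : Prop :=
  ∀ x y, d x y = ∑ᶠ A ∈ {A : Set X | IsDSplit d A Aᶜ ∧ x ∈ A ∧ y ∉ A}, isolIdx d A Aᶜ

/-- The cell `[f]` of `f ∈ E(X,d)`: all `g ∈ Δ(X,d)` with `A(f) ⊆ A(g)`. -/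
def cellOf (d : X → X → ℝ) (f : X → ℝ) : Set (X → ℝ) :=
  {g | g ∈ DeltaSet d ∧ ∀ x y, f x + f y = d x y → g x + g y = d x y}

open scoped ENNReal

/-- The sup-distance `d_∞(f, g) = sup_i |f i - g i|`, valued in `[0,∞]`. -/
def supDist {ι : Type*} (f g : ι → ℝ) : ℝ≥0∞ := ⨆ i, edist (f i) (g i)

/-- The map `Φ : [f] → ℝ^{G([f])}`, `Φ(g)(γ) = d_∞(g, γ)`, where the set of gates
`G([f])` is the range of the gate assignment `γ`. -/
def gatePhi (γ : X → X → ℝ) (g : X → ℝ) : ↥(Set.range γ) → ℝ :=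
  fun h => (supDist g h.1).toReal

/-- The injective hull `E(G([f]), d_∞)` of the metric space of gates. -/
def extOfGates (γ : X → X → ℝ) : Set (↥(Set.range γ) → ℝ) :=
  {F | ∀ a, IsLUB {r : ℝ | ∃ b : ↥(Set.range γ), r = (supDist a.1 b.1).toReal - F b} (F a)}

/-! ### Attainment: integer-valued metrics with the local rank condition -/

/-- A pointwise minimal integral solution of `e x y ≤ k x + k y` below a given one. -/
theorem exists_minimal_integral (e : X → X → ℝ) (k₀ : X → ℤ)
    (h₀ : ∀ x y, e x y ≤ k₀ x + k₀ y) (he : ∀ x, e x x = 0) :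
    ∃ k, k ≤ k₀ ∧ Minimal (fun k : X → ℤ => ∀ x y, e x y ≤ k x + k y) k := by
  obtain ⟨m, hm, hmin⟩ := zorn_le_nonempty₀
    {k : (X → ℤ)ᵒᵈ | ∀ x y, e x y ≤
      ((OrderDual.ofDual k : X → ℤ) x : ℝ) + (OrderDual.ofDual k : X → ℤ) y}
    (by
      intro c hc hchain y₀ hy₀
      have hbdd : ∀ x, BddBelow ((fun k : (X → ℤ)ᵒᵈ => OrderDual.ofDual k x) '' c) := by
        intro x
        refine ⟨0, ?_⟩
        rintro _ ⟨k, hk, rfl⟩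
        have h := hc hk x x
        rw [he] at h
        have h' : (0 : ℝ) ≤ (OrderDual.ofDual k x : ℝ) := by linarith
        exact_mod_cast h'
      refine ⟨OrderDual.toDual fun x =>
        sInf ((fun k : (X → ℤ)ᵒᵈ => (OrderDual.ofDual k : X → ℤ) x) '' c), ?_, ?_⟩
      · intro x y
        obtain ⟨k, hk, hkx⟩ := Int.csInf_mem (Set.Nonempty.image _ ⟨y₀, hy₀⟩) (hbdd x)
        obtain ⟨l, hl, hly⟩ := Int.csInf_mem (Set.Nonempty.image _ ⟨y₀, hy₀⟩) (hbdd y)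
        simp only [OrderDual.ofDual_toDual]
        rw [← hkx, ← hly]
        rcases hchain.total hk hl with h | h
        · have h1 := hc hl x y
          have h2 : OrderDual.ofDual l x ≤ OrderDual.ofDual k x := h x
          have h3 : (OrderDual.ofDual l x : ℝ) ≤ OrderDual.ofDual k x := by exact_mod_cast h2
          exact h1.trans (by linarith)
        · have h1 := hc hk x y
          have h2 : OrderDual.ofDual k y ≤ OrderDual.ofDual l y := h y
          have h3 : (OrderDual.ofDual k y : ℝ) ≤ OrderDual.ofDual l y := by exact_mod_cast h2
          exact h1.trans (by linarith)
      · intro k hk x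
        exact csInf_le (hbdd x) ⟨k, hk, rfl⟩)
    (OrderDual.toDual k₀) h₀
  exact ⟨OrderDual.ofDual m, hm, hmin.prop, fun l hl hle =>
    hmin.le_of_ge (y := OrderDual.toDual l) hl hle⟩

/-- `E'(X, d)` is dense in `E(X, d)` when `d` is integer-valued. -/
theorem exists_extSet'_near {d : X → X → ℝ} (hd : IsPseudometric d) (hint : IsIntegerValued d)
    {f : X → ℝ} (hf : f ∈ ExtSet d) {δ : ℝ} (hδ : 0 < δ) :
    ∃ g ∈ ExtSet' d, ∀ x, |f x - g x| < δ := by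
  obtain ⟨n, hn⟩ := exists_nat_one_div_lt hδ
  have hn0 : (0 : ℝ) < (n : ℝ) + 1 := by positivity
  have hfΔ : ∀ x y, d x y ≤ f x + f y := fun x y => by
    have := (hf x).1 ⟨y, rfl⟩
    linarith
  obtain ⟨k, hk, hkP, hkmin⟩ := exists_minimal_integral (fun x y => ((n : ℝ) + 1) * d x y)
    (fun x => ⌈((n : ℝ) + 1) * f x⌉)
    (fun x y => by
      have h1 := Int.le_ceil (((n : ℝ) + 1) * f x)
      have h2 := Int.le_ceil (((n : ℝ) + 1) * f y)
      have h3 := mul_le_mul_of_nonneg_left (hfΔ x y) hn0.le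
      linarith)
    (fun x => by simp [hd.1 x])
  have hΔ : ∀ x y, d x y ≤ k x / ((n : ℝ) + 1) + k y / ((n : ℝ) + 1) := fun x y => by
    rw [← add_div, le_div_iff₀ hn0]
    linarith [hkP x y]
  have hup : ∀ x, k x / ((n : ℝ) + 1) < f x + 1 / ((n : ℝ) + 1) := fun x => by
    have h1 : (k x : ℝ) ≤ ⌈((n : ℝ) + 1) * f x⌉ := by exact_mod_cast hk x
    have h2 := Int.ceil_lt_add_one (((n : ℝ) + 1) * f x)
    rw [div_lt_iff₀ hn0, add_mul, one_div, inv_mul_cancel₀ hn0.ne']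
    linarith
  have hlow : ∀ x, f x ≤ k x / ((n : ℝ) + 1) + 1 / ((n : ℝ) + 1) := fun x => by
    refine (hf x).2 ?_
    rintro _ ⟨y, rfl⟩
    linarith [hΔ x y, hup y]
  refine ⟨fun x => k x / ((n : ℝ) + 1), ⟨hΔ, fun x => ?_⟩, fun x => ?_⟩
  · classical
    have hnot : ¬ ∀ y z, ((n : ℝ) + 1) * d y z ≤
        (Function.update k x (k x - 1) y : ℝ) + Function.update k x (k x - 1) z := by
      intro h
      have h1 := hkmin h (by
        intro y
        by_cases hy : y = x
        · subst hy; simp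
        · simp [hy]) x
      simp at h1
    push Not at hnot
    have key : ∃ y, (k x : ℝ) + k y < ((n : ℝ) + 1) * d x y + 1 := by
      obtain ⟨y, z, hyz⟩ := hnot
      by_cases hy : y = x
      · subst hy
        by_cases hz : z = y
        · subst hz
          refine ⟨z, ?_⟩
          simp only [Function.update_self, hd.1, mul_zero] at hyz ⊢
          have h1 : (k z - 1) + (k z - 1) < 0 := by exact_mod_cast hyz
          have h2 : k z + k z < 1 := by lia
          rw [zero_add]
          exact_mod_cast h2
        · refine ⟨z, ?_⟩
          simp only [Function.update_self, Function.update_of_ne hz] at hyz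
          push_cast at hyz
          linarith
      · by_cases hz : z = x
        · subst hz
          refine ⟨y, ?_⟩
          simp only [Function.update_self, Function.update_of_ne hy] at hyz
          push_cast at hyz
          rw [hd.2.1 z y]
          linarith
        · simp only [Function.update_of_ne hz, Function.update_of_ne hy] at hyz
          linarith [hkP y z]
    obtain ⟨y, hy⟩ := key
    refine ⟨y, ?_⟩
    obtain ⟨m, hm⟩ := hint x y
    have h1 := hkP x y
    simp only [hm] at h1 hy ⊢
    have h2 : ((n : ℤ) + 1) * m ≤ k x + k y := by exact_mod_cast h1
    have h3 : k x + k y < ((n : ℤ) + 1) * m + 1 := by exact_mod_cast hy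
    have h4 : k x + k y = ((n : ℤ) + 1) * m := by lia
    have h5 : (k x : ℝ) + k y = ((n : ℝ) + 1) * m := by exact_mod_cast h4
    rw [← add_div, h5, mul_div_cancel_left₀ _ hn0.ne']
  · rw [abs_lt]
    constructor <;> linarith [hup x, hlow x]

/-- Points whose values are pairwise inequivalent modulo `±` and `ℤ` bound the rank from below. -/
theorem card_le_rank_dirSubmodule {d : X → X → ℝ} (hint : IsIntegerValued d) (g : X → ℝ)
    {m : ℕ} (y : Fin m → X) (hadd : ∀ i j, ∀ z : ℤ, g (y i) + g (y j) ≠ z)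
    (hsub : ∀ i j, i ≠ j → ∀ z : ℤ, g (y i) - g (y j) ≠ z) :
    (m : Cardinal) ≤ Module.rank ℝ (dirSubmodule (eqSet d g)) := by
  classical
  let φ : ℝ → ℝ → ℝ := fun c t =>
    (if ∃ z : ℤ, t - c = z then 1 else 0) - (if ∃ z : ℤ, t + c = z then 1 else 0)
  have hφ : ∀ c s t : ℝ, (∃ z : ℤ, s + t = z) → φ c s + φ c t = 0 := by
    rintro c s t ⟨z, hz⟩
    have h1 : (∃ w : ℤ, s - c = w) ↔ ∃ w : ℤ, t + c = w :=
      ⟨fun ⟨w, hw⟩ => ⟨z - w, by push_cast; linarith⟩,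
        fun ⟨w, hw⟩ => ⟨z - w, by push_cast; linarith⟩⟩
    have h2 : (∃ w : ℤ, s + c = w) ↔ ∃ w : ℤ, t - c = w :=
      ⟨fun ⟨w, hw⟩ => ⟨z - w, by push_cast; linarith⟩,
        fun ⟨w, hw⟩ => ⟨z - w, by push_cast; linarith⟩⟩
    simp only [φ, h1, h2]
    ring
  let v : Fin m → dirSubmodule (eqSet d g) := fun i =>
    ⟨fun x => φ (g (y i)) (g x), fun p hp => hφ _ _ _ (by
      obtain ⟨z, hz⟩ := hint p.1 p.2
      exact ⟨z, (show g p.1 + g p.2 = d p.1 p.2 from hp).trans hz⟩)⟩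
  have hv : ∀ i j, (v i : X → ℝ) (y j) = if i = j then 1 else 0 := by
    intro i j
    have h1 : ¬ ∃ z : ℤ, g (y j) + g (y i) = z := fun ⟨z, hz⟩ => hadd j i z hz
    by_cases hij : i = j
    · subst hij
      have h2 : ∃ z : ℤ, g (y i) - g (y i) = z := ⟨0, by simp⟩
      simp only [v, φ, if_neg h1, if_pos h2, if_true, sub_zero]
    · have h2 : ¬ ∃ z : ℤ, g (y j) - g (y i) = z := fun ⟨z, hz⟩ => hsub j i (Ne.symm hij) z hz
      simp only [v, φ, if_neg h1, if_neg h2, if_neg hij, sub_zero]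
  have hli : LinearIndependent ℝ v := by
    rw [Fintype.linearIndependent_iff]
    intro c hc j
    have h := congrArg (fun w : dirSubmodule (eqSet d g) => (w : X → ℝ) (y j)) hc
    simpa [Finset.sum_apply, hv] using h
  simpa using hli.cardinal_lift_le_rank

/-- Under the local rank condition, an integer-valued metric satisfies `E(X, d) ⊆ E'(X, d)`. -/
theorem extSet_subset_extSet' {d : X → X → ℝ} (hd : IsPseudometric d) (hint : IsIntegerValued d)
    (hlrc : LRC d) {f : X → ℝ} (hf : f ∈ ExtSet d) : f ∈ ExtSet' d := by
  have hfΔ : ∀ x y, d x y ≤ f x + f y := fun x y => by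
    have := (hf x).1 ⟨y, rfl⟩
    linarith
  refine ⟨hfΔ, fun x => ?_⟩
  by_contra! hne
  obtain ⟨ε, hε, N, hN⟩ := hlrc f hf
  have hpos : ∀ y, 0 < f x + f y - d x y := fun y => by
    have := lt_of_le_of_ne (hfΔ x y) (hne y).symm
    linarith
  have hsmall : ∀ η > 0, ∃ y, f x + f y - d x y < η := by
    intro η hη
    by_contra! h
    have : f x ≤ f x - η := (hf x).2 (by
      rintro _ ⟨y, rfl⟩
      linarith [h y])
    linarith
  obtain ⟨η, hη, hη1, hηZ⟩ : ∃ η > 0, η ≤ 1 / 2 ∧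
      ∀ u v : ℝ, 0 < u → u < η → 0 < v → v < η → ∀ z : ℤ, u + v - 2 * f x ≠ z := by
    have h1 := Int.fract_lt_one (2 * f x)
    have h2 := Int.floor_add_fract (2 * f x)
    rcases (Int.fract_nonneg (2 * f x)).eq_or_lt with h0 | h0
    · refine ⟨1 / 2, by norm_num, le_rfl, fun u v hu hu' hv hv' z hz => ?_⟩
      have h3 : (0 : ℝ) < ((z + ⌊2 * f x⌋ : ℤ) : ℝ) := by push_cast; linarith
      have h4 : ((z + ⌊2 * f x⌋ : ℤ) : ℝ) < ((1 : ℤ) : ℝ) := by push_cast; linarith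
      have h5 : 0 < z + ⌊2 * f x⌋ := by exact_mod_cast h3
      have h6 : z + ⌊2 * f x⌋ < 1 := by exact_mod_cast h4
      lia
    · refine ⟨Int.fract (2 * f x) / 2, by linarith, by linarith,
        fun u v hu hu' hv hv' z hz => ?_⟩
      have h3 : ((-1 : ℤ) : ℝ) < ((z + ⌊2 * f x⌋ : ℤ) : ℝ) := by push_cast; linarith
      have h4 : ((z + ⌊2 * f x⌋ : ℤ) : ℝ) < 0 := by push_cast; linarith
      have h5 : -1 < z + ⌊2 * f x⌋ := by exact_mod_cast h3
      have h6 : z + ⌊2 * f x⌋ < 0 := by exact_mod_cast h4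
      lia
  obtain ⟨y, hyη, hydec⟩ : ∃ y : ℕ → X, (∀ i, f x + f (y i) - d x (y i) < η) ∧
      StrictAnti fun i => f x + f (y i) - d x (y i) := by
    choose c hc using fun w : X => hsmall (min η (f x + f w - d x w)) (lt_min hη (hpos w))
    obtain ⟨y₀, hy₀⟩ := hsmall η hη
    refine ⟨fun i => c^[i] y₀, fun i => ?_, strictAnti_nat_of_succ_lt fun i => ?_⟩
    · cases i with
      | zero => exact hy₀
      | succ i =>
        simp only [Function.iterate_succ_apply']
        exact (hc _).trans_le (min_le_left _ _)
    · simp only [Function.iterate_succ_apply']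
      exact (hc _).trans_le (min_le_right _ _)
  have hadd : ∀ i j, ∀ z : ℤ, f (y i) + f (y j) ≠ z := by
    intro i j z hz
    obtain ⟨a, ha⟩ := hint x (y i)
    obtain ⟨b, hb⟩ := hint x (y j)
    refine hηZ _ _ (hpos (y i)) (hyη i) (hpos (y j)) (hyη j) (z - a - b) ?_
    push_cast
    linarith
  have hsub : ∀ i j, i ≠ j → ∀ z : ℤ, f (y i) - f (y j) ≠ z := by
    intro i j hij z hz
    obtain ⟨a, ha⟩ := hint x (y i)
    obtain ⟨b, hb⟩ := hint x (y j)
    have h1 := hpos (y i)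
    have h2 := hpos (y j)
    have h3 := hyη i
    have h4 := hyη j
    have h5 : ((-1 : ℤ) : ℝ) < ((z - a + b : ℤ) : ℝ) := by push_cast; linarith
    have h6 : ((z - a + b : ℤ) : ℝ) < ((1 : ℤ) : ℝ) := by push_cast; linarith
    have h7 : -1 < z - a + b := by exact_mod_cast h5
    have h8 : z - a + b < 1 := by exact_mod_cast h6
    have h9 : z - a + b = 0 := by lia
    have h10 : (z : ℝ) - a + b = 0 := by exact_mod_cast h9
    exact hij (hydec.injective (by linarith))
  have hopen : ∀ t : ℝ, (∀ z : ℤ, t ≠ z) → ∃ δ > 0, ∀ s, |t - s| < δ → ∀ z : ℤ, s ≠ z := by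
    intro t ht
    obtain ⟨δ, hδ, h⟩ := Metric.isOpen_iff.1
      Int.isClosedEmbedding_coe_real.isClosed_range.isOpen_compl t
      (fun ⟨z, hz⟩ => ht z hz.symm)
    refine ⟨δ, hδ, fun s hs z hz => h (a := s) ?_ ⟨z, hz.symm⟩⟩
    rwa [Metric.mem_ball, dist_comm, Real.dist_eq]
  choose δ₁ hδ₁ hδ₁' using fun i j => hopen _ (hadd i j)
  choose δ₂ hδ₂ hδ₂' using fun (p : {p : ℕ × ℕ // p.1 ≠ p.2}) => hopen _ (hsub _ _ p.2)
  obtain ⟨δ, hδ, hδε, hδ1, hδ2⟩ : ∃ δ > 0, δ ≤ ε ∧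
      (∀ i j : Fin (N + 1), 2 * δ ≤ δ₁ i j) ∧
      ∀ i j : Fin (N + 1), ∀ h : (i : ℕ) ≠ j, 2 * δ ≤ δ₂ ⟨(i, j), h⟩ := by
    have e1 : ∀ᶠ δ in nhdsWithin (0 : ℝ) (Set.Ioi 0), δ ≤ ε :=
      nhdsWithin_le_nhds (eventually_le_nhds hε)
    have e : ∀ c > (0 : ℝ), ∀ᶠ δ in nhdsWithin (0 : ℝ) (Set.Ioi 0), 2 * δ ≤ c := by
      intro c hc
      filter_upwards [nhdsWithin_le_nhds (eventually_le_nhds (half_pos hc))] with δ h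
      linarith
    have e2 : ∀ᶠ δ in nhdsWithin (0 : ℝ) (Set.Ioi 0),
        ∀ i j : Fin (N + 1), 2 * δ ≤ δ₁ i j := by
      simp only [Filter.eventually_all]
      exact fun i j => e _ (hδ₁ i j)
    have e3 : ∀ᶠ δ in nhdsWithin (0 : ℝ) (Set.Ioi 0),
        ∀ i j : Fin (N + 1), ∀ h : (i : ℕ) ≠ j, 2 * δ ≤ δ₂ ⟨(i, j), h⟩ := by
      simp only [Filter.eventually_all]
      exact fun i j h => e _ (hδ₂ _)
    obtain ⟨δ, hδ, h1, h2, h3⟩ :=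
      (eventually_mem_nhdsWithin.and (e1.and (e2.and e3))).exists
    exact ⟨δ, hδ, h1, h2, h3⟩
  obtain ⟨g, hg, hfg⟩ := exists_extSet'_near hd hint hf hδ
  have hle := (card_le_rank_dirSubmodule hint g (fun i : Fin (N + 1) => y i)
    (fun i j => hδ₁' i j _ (by
      have h1 := abs_lt.1 (hfg (y i))
      have h2 := abs_lt.1 (hfg (y j))
      have h3 := hδ1 i j
      rw [abs_lt]
      constructor <;> linarith))
    (fun i j hij => hδ₂' ⟨(i, j), fun h => hij (Fin.ext h)⟩ _ (by
      have h1 := abs_lt.1 (hfg (y i))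
      have h2 := abs_lt.1 (hfg (y j))
      have h3 := hδ2 i j (fun h => hij (Fin.ext h))
      simp only
      rw [abs_lt]
      constructor <;> linarith))).trans (hN g hg fun x => (hfg x).trans_le hδε)
  have : N + 1 ≤ N := by exact_mod_cast hle
  lia

/-! ### The sup-distance on a cell -/

section supDist

variable {ι : Type*}

theorem supDist_comm (f g : ι → ℝ) : supDist f g = supDist g f := by
  simp only [supDist, edist_comm]

theorem supDist_triangle (f g h : ι → ℝ) : supDist f h ≤ supDist f g + supDist g h :=
  iSup_le fun i => (edist_triangle _ (g i) _).trans
    (add_le_add (le_iSup (fun i => edist (f i) (g i)) i) (le_iSup (fun i => edist (g i) (h i)) i))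

theorem eq_of_supDist_eq_zero {f g : ι → ℝ} (h : supDist f g = 0) : f = g := by
  funext i
  exact edist_eq_zero.1 (ENNReal.iSup_eq_zero.1 h i)

end supDist

/-- In a cell of an element of `E'(X, d)`, the distance from `d_x` is evaluation at `x`. -/
theorem supDist_dist_eq {d : X → X → ℝ} (hd : IsPseudometric d) {f : X → ℝ} (hf : f ∈ ExtSet' d)
    {g : X → ℝ} (hg : g ∈ cellOf d f) (x : X) : supDist (d x) g = ENNReal.ofReal (g x) := by
  refine le_antisymm (iSup_le fun y => ?_) ?_
  · rw [edist_dist]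
    refine ENNReal.ofReal_le_ofReal ?_
    rw [Real.dist_eq, abs_le]
    obtain ⟨z, hz⟩ := hf.2 y
    have h1 := hg.2 y z hz
    constructor <;> linarith [hg.1 x y, hg.1 x z, hd.2.2 y x z, hd.2.1 x y]
  · refine le_trans ?_ (le_iSup (fun y => edist (d x y) (g y)) x)
    rw [edist_dist, Real.dist_eq, hd.1, zero_sub, abs_neg]
    exact ENNReal.ofReal_le_ofReal (le_abs_self _)

theorem nonneg_of_mem_cellOf {d : X → X → ℝ} (hd : IsPseudometric d) {f g : X → ℝ}
    (hg : g ∈ cellOf d f) (x : X) : 0 ≤ g x := by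
  linarith [hg.1 x x, hd.1 x]

theorem supDist_ne_top {d : X → X → ℝ} (hd : IsPseudometric d) {f : X → ℝ} (hf : f ∈ ExtSet' d)
    {g h : X → ℝ} (hg : g ∈ cellOf d f) (hh : h ∈ cellOf d f) : supDist g h ≠ ⊤ := by
  rcases isEmpty_or_nonempty X with hX | ⟨⟨x⟩⟩
  · simp [supDist]
  · refine ne_top_of_le_ne_top ?_ (supDist_triangle g (d x) h)
    rw [supDist_comm g, supDist_dist_eq hd hf hg, supDist_dist_eq hd hf hh]
    exact ENNReal.add_ne_top.2 ⟨ENNReal.ofReal_ne_top, ENNReal.ofReal_ne_top⟩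

/-- The real distance from a cell element to the gate of `x`. -/
theorem toReal_supDist_gate {d : X → X → ℝ} (hd : IsPseudometric d) {f : X → ℝ}
    (hf : f ∈ ExtSet' d) {γ : X → X → ℝ} (hγmem : ∀ x, γ x ∈ cellOf d f)
    (hγgate : ∀ x, ∀ h ∈ cellOf d f,
      supDist (d x) h = supDist (d x) (γ x) + supDist (γ x) h)
    {g : X → ℝ} (hg : g ∈ cellOf d f) (x : X) : (supDist g (γ x)).toReal = g x - γ x x := by
  have h := congrArg ENNReal.toReal (hγgate x g hg)
  rw [supDist_dist_eq hd hf hg, supDist_dist_eq hd hf (hγmem x),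
    ENNReal.toReal_add ENNReal.ofReal_ne_top (supDist_ne_top hd hf (hγmem x) hg),
    ENNReal.toReal_ofReal (nonneg_of_mem_cellOf hd hg x),
    ENNReal.toReal_ofReal (nonneg_of_mem_cellOf hd (hγmem x) x), supDist_comm] at h
  linarith

/-- Gates of two points joined in `A(f)` are antipodal, even with respect to the whole cell. -/
theorem toReal_supDist_gate_add {d : X → X → ℝ} (hd : IsPseudometric d) {f : X → ℝ}
    (hf : f ∈ ExtSet' d) {γ : X → X → ℝ} (hγmem : ∀ x, γ x ∈ cellOf d f)
    (hγgate : ∀ x, ∀ h ∈ cellOf d f,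
      supDist (d x) h = supDist (d x) (γ x) + supDist (γ x) h)
    {x y : X} (hxy : f x + f y = d x y) {g : X → ℝ} (hg : g ∈ cellOf d f) :
    (supDist (γ x) (γ y)).toReal = (supDist g (γ x)).toReal + (supDist g (γ y)).toReal := by
  rw [toReal_supDist_gate hd hf hγmem hγgate hg, toReal_supDist_gate hd hf hγmem hγgate hg,
    toReal_supDist_gate hd hf hγmem hγgate (hγmem x)]
  linarith [hg.2 x y hxy, (hγmem x).2 x y hxy]

theorem statement17 (d : X → X → ℝ) (hmet : IsMetric d) (hint : IsIntegerValued d)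
    (hlrc : LRC d) (f : X → ℝ) (hf : f ∈ ExtSet d)
    (γ : X → X → ℝ)
    (hγmem : ∀ x, γ x ∈ cellOf d f)
    (hγgate : ∀ x, ∀ h ∈ cellOf d f,
      supDist (d x) h = supDist (d x) (γ x) + supDist (γ x) h) :
    (∃ σ : (X → ℝ) → (X → ℝ),
        (∀ g ∈ Set.range γ, σ g ∈ Set.range γ) ∧
        (∀ g ∈ Set.range γ, σ (σ g) = g) ∧
        ∀ g ∈ Set.range γ, ∀ h ∈ Set.range γ,
          supDist g (σ g) = supDist g h + supDist h (σ g)) ∧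
    (∀ g ∈ cellOf d f, gatePhi γ g ∈ extOfGates γ) ∧
    Set.InjOn (gatePhi γ) (cellOf d f) ∧
    (∀ F ∈ extOfGates γ, ∃ g ∈ cellOf d f, gatePhi γ g = F) ∧
    (∀ g ∈ cellOf d f, ∀ h ∈ cellOf d f,
      supDist (gatePhi γ g) (gatePhi γ h) = supDist g h) ∧
    (∀ g ∈ cellOf d f, ∀ x : X,
      gatePhi γ g ⟨γ x, Set.mem_range_self x⟩ = g x - γ x x) ∧
    ∃ T : (X → ℝ) →ᵃ[ℝ] (↥(Set.range γ) → ℝ),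
      ∀ g ∈ cellOf d f, T g = gatePhi γ g := by
  have hd := hmet.1
  have hf' := extSet_subset_extSet' hd hint hlrc hf
  have hΦ : ∀ g ∈ cellOf d f, ∀ x, (supDist g (γ x)).toReal = g x - γ x x :=
    fun g hg x => toReal_supDist_gate hd hf' hγmem hγgate hg x
  have hfin : ∀ g ∈ cellOf d f, ∀ h ∈ cellOf d f, supDist g h ≠ ⊤ :=
    fun g hg h hh => supDist_ne_top hd hf' hg hh
  have hanti : ∀ x y, f x + f y = d x y → ∀ g ∈ cellOf d f,
      (supDist (γ x) (γ y)).toReal = (supDist g (γ x)).toReal + (supDist g (γ y)).toReal :=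
    fun x y hxy g hg => toReal_supDist_gate_add hd hf' hγmem hγgate hxy hg
  have htri : ∀ a ∈ cellOf d f, ∀ b ∈ cellOf d f, ∀ c ∈ cellOf d f,
      (supDist a c).toReal ≤ (supDist a b).toReal + (supDist b c).toReal := by
    intro a ha b hb c hc
    rw [← ENNReal.toReal_add (hfin a ha b hb) (hfin b hb c hc)]
    exact ENNReal.toReal_mono (ENNReal.add_ne_top.2 ⟨hfin a ha b hb, hfin b hb c hc⟩)
      (supDist_triangle a b c)
  choose p hp using hf'.2
  have hiso : ∀ g ∈ cellOf d f, ∀ h ∈ cellOf d f,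
      supDist (gatePhi γ g) (gatePhi γ h) = supDist g h := by
    intro g hg h hh
    have hterm : ∀ x, edist (gatePhi γ g ⟨γ x, Set.mem_range_self x⟩)
        (gatePhi γ h ⟨γ x, Set.mem_range_self x⟩) = edist (g x) (h x) := by
      intro x
      simp only [gatePhi]
      rw [hΦ g hg, hΦ h hh, edist_dist, edist_dist, Real.dist_eq, Real.dist_eq]
      congr 2
      ring
    refine le_antisymm (iSup_le ?_) (iSup_le fun x => ?_)
    · rintro ⟨_, x, rfl⟩
      rw [hterm]
      exact le_iSup (fun x => edist (g x) (h x)) x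
    · rw [← hterm]
      exact le_iSup (fun a => edist (gatePhi γ g a) (gatePhi γ h a)) _
  refine ⟨?_, ?_, ?_, ?_, hiso, fun g hg x => hΦ g hg x, ?_⟩
  · let IsAntipode : (X → ℝ) → (X → ℝ) → Prop := fun g h =>
      h ∈ Set.range γ ∧ ∀ k ∈ Set.range γ, supDist g h = supDist g k + supDist k h
    have hex : ∀ x, IsAntipode (γ x) (γ (p x)) := by
      refine fun x => ⟨⟨p x, rfl⟩, ?_⟩
      rintro _ ⟨z, rfl⟩
      have h1 := hfin _ (hγmem x) _ (hγmem z)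
      have h2 := hfin _ (hγmem z) _ (hγmem (p x))
      rw [← ENNReal.toReal_eq_toReal_iff' (hfin _ (hγmem x) _ (hγmem (p x)))
        (ENNReal.add_ne_top.2 ⟨h1, h2⟩), ENNReal.toReal_add h1 h2,
        hanti x (p x) (hp x) _ (hγmem z), supDist_comm (γ z) (γ x)]
    have hex' : ∀ g, ∃ h, g ∈ Set.range γ → IsAntipode g h := by
      intro g
      by_cases hg : g ∈ Set.range γ
      · obtain ⟨x, rfl⟩ := hg
        exact ⟨_, fun _ => hex x⟩
      · exact ⟨g, fun h => absurd h hg⟩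
    choose σ hσ using hex'
    refine ⟨σ, fun g hg => (hσ g hg).1, fun g hg => ?_, fun g hg => (hσ g hg).2⟩
    have hs := (hσ g hg).1
    have e1 := (hσ g hg).2 _ (hσ _ hs).1
    have e2 := (hσ _ hs).2 g hg
    have hmem : ∀ k ∈ Set.range γ, k ∈ cellOf d f := by
      rintro _ ⟨x, rfl⟩
      exact hγmem x
    rw [supDist_comm (σ (σ g)) (σ g), e2, supDist_comm (σ g) g, add_left_comm] at e1
    have e3 := (ENNReal.add_right_inj (hfin _ (hmem _ hg) _ (hmem _ hs))).1 ((add_zero _).trans e1)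
    exact (eq_of_supDist_eq_zero (add_eq_zero.1 e3.symm).1).symm
  · intro g hg
    rintro ⟨_, x, rfl⟩
    refine ⟨?_, fun u hu => ?_⟩
    · rintro _ ⟨⟨_, y, rfl⟩, rfl⟩
      have := htri _ (hγmem x) g hg _ (hγmem y)
      rw [supDist_comm (γ x) g] at this
      simp only [gatePhi]
      linarith
    · refine le_trans (le_of_eq ?_) (hu ⟨⟨γ (p x), Set.mem_range_self _⟩, rfl⟩)
      simp only [gatePhi]
      linarith [hanti x (p x) (hp x) g hg]
  · intro g hg h hh hgh
    refine eq_of_supDist_eq_zero ?_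
    rw [← hiso g hg h hh, hgh]
    simp [supDist]
  · intro F hF
    have hFΔ : ∀ a b, (supDist a.1 b.1).toReal ≤ F a + F b := fun a b => by
      have := (hF a).1 ⟨b, rfl⟩
      linarith
    have hFlip : ∀ x y, F ⟨γ x, Set.mem_range_self x⟩ ≤
        (supDist (γ x) (γ y)).toReal + F ⟨γ y, Set.mem_range_self y⟩ := by
      intro x y
      refine (hF _).2 ?_
      rintro _ ⟨⟨_, z, rfl⟩, rfl⟩
      have h1 := htri _ (hγmem x) _ (hγmem y) _ (hγmem z)
      have h2 := hFΔ ⟨γ y, Set.mem_range_self y⟩ ⟨γ z, Set.mem_range_self z⟩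
      simp only at h2 ⊢
      linarith
    have hcell : (fun x => γ x x + F ⟨γ x, Set.mem_range_self x⟩) ∈ cellOf d f := by
      refine ⟨fun x y => ?_, fun x y hxy => ?_⟩
      · have h1 := hFΔ ⟨γ x, Set.mem_range_self x⟩ ⟨γ y, Set.mem_range_self y⟩
        simp only at h1
        rw [hΦ _ (hγmem x)] at h1
        linarith [(hγmem x).1 x y]
      · have h1 := hFΔ ⟨γ x, Set.mem_range_self x⟩ ⟨γ y, Set.mem_range_self y⟩
        have h2 : F ⟨γ x, Set.mem_range_self x⟩ ≤
            (supDist (γ x) (γ y)).toReal - F ⟨γ y, Set.mem_range_self y⟩ := by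
          refine (hF _).2 ?_
          rintro _ ⟨⟨_, z, rfl⟩, rfl⟩
          have h3 := hFlip y z
          have h4 := hanti x y hxy _ (hγmem z)
          rw [supDist_comm (γ z), supDist_comm (γ z)] at h4
          simp only
          linarith
        simp only at h1
        rw [hΦ _ (hγmem x)] at h1 h2
        linarith [(hγmem x).2 x y hxy]
    refine ⟨_, hcell, ?_⟩
    funext ⟨_, x, rfl⟩
    simp only [gatePhi]
    rw [hΦ _ hcell]
    ring
  · choose r hr using fun a : ↥(Set.range γ) => a.2
    refine ⟨(LinearMap.funLeft ℝ ℝ r).toAffineMap +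
      AffineMap.const ℝ (X → ℝ) (fun a => - γ (r a) (r a)), fun g hg => ?_⟩
    funext a
    have h := hΦ g hg (r a)
    simp only [gatePhi]
    rw [← hr a, h]
    simp [LinearMap.funLeft_apply, sub_eq_add_neg]
end
end

section
/- Let κ: (A,d) → (A',d') be a map between metric spaces such that: (i) κ is 1-Lipschitz; (ii) κ is surjective; (iii) (A,d) is an antipodal metric space, with antipodal involution σ; and (iv) for every x ∈ A there is a point y ∈ A antipodal to x (i.e. y = σ(x)) such that d(x,y) = d'(κ(x), κ(y)). Then κ is an isometry. -/
open Function

theorem statement19 {A : Type*} {A' : Type*} [MetricSpace A] [MetricSpace A']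
    (κ : A → A') (hlip : LipschitzWith 1 κ) (hsurj : Surjective κ)
    (σ : A → A) (hinv : Involutive σ)
    (hant : ∀ x y : A, dist x (σ x) = dist x y + dist y (σ x))
    (hdist : ∀ x : A, dist x (σ x) = dist (κ x) (κ (σ x))) :
    Isometry κ := by
  refine Isometry.of_dist_eq fun x y => ?_
  have hxy : dist (κ x) (κ y) ≤ dist x y := by simpa using hlip.dist_le_mul x y
  have hyσ : dist (κ y) (κ (σ x)) ≤ dist y (σ x) := by simpa using hlip.dist_le_mul y (σ x)
  linarith [hant x y, hdist x, dist_triangle (κ x) (κ y) (κ (σ x))]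
end
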